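/- (KP–Toda bilinear identities for the dark Gram tau function.) Let M ≥ 1, N ≥ 1 and let c_{ij}, p_i, q_j, ξ_{i,0}, η_{j,0} ∈ ℂ and a₁,…,a_M ∈ ℂ with p_i + q_j ≠ 0, p_i ≠ a_n, q_j ≠ −a_n for all i,j,n. On variables (x,y,t,x_{−1}^{(1)},…,x_{−1}^{(M)}) ∈ ℝ^{3+M}, set ξ_i = p_ix + p_i²y + p_i³t + Σ_{n=1}^{M} x_{−1}^{(n)}/(p_i − a_n) + ξ_{i,0} and η_j = q_jx − q_j²y + q_j³t + Σ_{n=1}^{M} x_{−1}^{(n)}/(q_j + a_n) + η_{j,0}. For 𝐧 = (k₁,…,k_M) ∈ ℤ^M define τ_𝐧 = det(c_{ij} + (e^{ξ_i+η_j}/(p_i+q_j))·Π_{n=1}^{M}(−(p_i−a_n)/(q_j+a_n))^{k_n})_{1≤i,j≤N}. Then for all k, l ∈ {1,…,M} and all 𝐧 ∈ ℤ^M (with 𝐞_k the k-th standard unit vector of ℤ^M): (D_{x_{−1}^{(k)}}D_x − 2)τ_𝐧·τ_𝐧 = −2τ_{𝐧+𝐞_k}τ_{𝐧−𝐞_k};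 (D_x² − D_y + 2a_kD_x)τ_{𝐧+𝐞_k}·τ_𝐧 = 0; (D_x³ + 3D_xD_y − 4D_t + 3a_k(D_x² + D_y) + 6a_k²D_x)τ_{𝐧+𝐞_k}·τ_𝐧 = 0; (D_{x_{−1}^{(l)}}(D_x² − D_y + 2a_kD_x) − 4(D_x + a_k − a_l))τ_{𝐧+𝐞_k}·τ_𝐧 + 4(a_k − a_l)τ_{𝐧+𝐞_k+𝐞_l}·τ_{𝐧−𝐞_l} = 0; and (D_x + a_k − a_l)τ_{𝐧+𝐞_k}·τ_{𝐧+𝐞_l} = (a_k − a_l)τ_{𝐧+𝐞_k+𝐞_l}τ_𝐧. -/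

import Mathlib

open Complex

noncomputable section

/-- Partial derivative of a function of `K` real variables in coordinate `j`. -/
def pd {K : ℕ} (j : Fin K) (F : (Fin K → ℝ) → ℂ) : (Fin K → ℝ) → ℂ :=
  fun z => deriv (fun s : ℝ => F (Function.update z j s)) (z j)

/-- Mixed partial derivative `∏_j ∂_{z_j}^{m j}`. -/
def mixedPD {K : ℕ} (m : Fin K → ℕ) (F : (Fin K → ℝ) → ℂ) : (Fin K → ℝ) → ℂ :=
  (List.finRange K).foldr (fun j G => (pd j)^[m j] G) F

/-- The multivariate Hirota bilinear operator `∏_j D_{z_j}^{m j} a·b`. -/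
def Hirota {K : ℕ} (m : Fin K → ℕ) (a b : (Fin K → ℝ) → ℂ) (z : Fin K → ℝ) : ℂ :=
  mixedPD m (fun s => a (z + s) * b (z - s)) 0

/-- Bordered determinant matrix: `[[A, Φ], [-Ψᵀ, 0]]`. -/
def border {N : ℕ} (A : Matrix (Fin N) (Fin N) ℂ) (Φ Ψ : Fin N → ℂ) :
    Matrix (Fin (N + 1)) (Fin (N + 1)) ℂ :=
  Matrix.of fun i j =>
    if hi : (i : ℕ) < N then
      if hj : (j : ℕ) < N then A ⟨i, hi⟩ ⟨j, hj⟩ else Φ ⟨i, hi⟩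
    else if hj : (j : ℕ) < N then -Ψ ⟨j, hj⟩ else 0

/-- Doubly bordered determinant matrix: `[[A, Φ₁, Φ₂], [-Ψ₁ᵀ, 0, 0], [-Ψ₂ᵀ, 0, 0]]`. -/
def border2 {N : ℕ} (A : Matrix (Fin N) (Fin N) ℂ) (Φ₁ Φ₂ Ψ₁ Ψ₂ : Fin N → ℂ) :
    Matrix (Fin (N + 2)) (Fin (N + 2)) ℂ :=
  Matrix.of fun i j =>
    if hi : (i : ℕ) < N then
      if hj : (j : ℕ) < N then A ⟨i, hi⟩ ⟨j, hj⟩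
      else if (j : ℕ) = N then Φ₁ ⟨i, hi⟩ else Φ₂ ⟨i, hi⟩
    else if hj : (j : ℕ) < N then
      if (i : ℕ) = N then -Ψ₁ ⟨j, hj⟩ else -Ψ₂ ⟨j, hj⟩
    else 0

section Algebra

open MvPolynomial

variable {V : Type*} [CommRing V]

/-- The derivation of the polynomial ring in the brackets `⟨f, g⟩`, `f g : V`, given by
`⟨f, g⟩ ↦ ⟨α f, g⟩ + ⟨f, β g⟩ - ∑ ⟨f', g⟩ ⟨f, g'⟩`, where `(f', g')` runs through `L`. -/
def bracketDeriv (α β : V) (L : List (V × V)) :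
    Derivation ℂ (MvPolynomial (V × V) ℂ) (MvPolynomial (V × V) ℂ) :=
  mkDerivation ℂ fun x =>
    X (α * x.1, x.2) + X (x.1, β * x.2) - (L.map fun r => X (r.1, x.2) * X (x.1, r.2)).sum

/-- `P ↦ τ⁻¹ ∂(τ P)`, for a function `τ` with logarithmic derivative `∑ ⟨f', g'⟩`. -/
def covDeriv (α β : V) (L : List (V × V)) (P : MvPolynomial (V × V) ℂ) :
    MvPolynomial (V × V) ℂ :=
  (L.map X).sum * P + bracketDeriv α β L P

/-- Covariant derivative in `x`. -/
abbrev covX (p q : V) := covDeriv p q [(1, 1)]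

/-- Covariant derivative in `y`. -/
abbrev covY (p q : V) := covDeriv (p * p) (-(q * q)) [(p, 1), (-1, q)]

/-- Covariant derivative in `t`. -/
abbrev covT (p q : V) :=
  covDeriv (p * (p * p)) (q * (q * q)) [(p * p, 1), (-p, q), (1, q * q)]

/-- Covariant derivative in a variable of negative weight. -/
abbrev covW (r s : V) := covDeriv r s [(r, s)]

/-- Evaluation of the brackets by means of a bilinear form. -/
def bracketEval [Algebra ℂ V] (b : V →ₗ[ℂ] V →ₗ[ℂ] ℂ) : MvPolynomial (V × V) ℂ →ₐ[ℂ] ℂ :=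
  aeval fun x => b x.1 x.2

/-- Iterated bilinear (Hirota) derivative with respect to a list of operators, the head of the
list acting first. -/
def hirotaForm {R : Type*} (e : R → ℂ) : List (R → R) → R → R → ℂ
  | [], P, Q => e P * e Q
  | d :: l, P, Q => hirotaForm e l (d P) Q - hirotaForm e l P (d Q)

variable [Algebra ℂ V] (b : V →ₗ[ℂ] V →ₗ[ℂ] ℂ)

theorem hirotaForm_toda {p q r s : V} {a : ℂ} (hr : p * r = 1 + a • r) (hs : q * s = 1 - a • s) :
    hirotaForm (bracketEval b) [covW r s, covX p q] 1 1 - 2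
      = -2 * bracketEval b (1 - X (1, s)) * bracketEval b (1 - X (r, 1)) := by
  simp [hirotaForm, covDeriv, bracketDeriv, bracketEval, hr, hs, mkDerivation_X]
  ring

theorem hirotaForm_mkp_two {p q h : V} {a : ℂ} (hh : q * h = 1 - a • h) :
    hirotaForm (bracketEval b) [covX p q, covX p q] (1 - X (1, h)) 1
      - hirotaForm (bracketEval b) [covY p q] (1 - X (1, h)) 1
      + 2 * a * hirotaForm (bracketEval b) [covX p q] (1 - X (1, h)) 1 = 0 := by
  simp [hirotaForm, covDeriv, bracketDeriv, bracketEval, hh, mkDerivation_X, mul_assoc, mul_sub,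
    mul_add]
  ring

theorem hirotaForm_mkp_three {p q h : V} {a : ℂ} (hh : q * h = 1 - a • h) :
    hirotaForm (bracketEval b) [covX p q, covX p q, covX p q] (1 - X (1, h)) 1
      + 3 * hirotaForm (bracketEval b) [covY p q, covX p q] (1 - X (1, h)) 1
      - 4 * hirotaForm (bracketEval b) [covT p q] (1 - X (1, h)) 1
      + 3 * a * (hirotaForm (bracketEval b) [covX p q, covX p q] (1 - X (1, h)) 1
          + hirotaForm (bracketEval b) [covY p q] (1 - X (1, h)) 1)
      + 6 * a ^ 2 * hirotaForm (bracketEval b) [covX p q] (1 - X (1, h)) 1 = 0 := by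
  simp [hirotaForm, covDeriv, bracketDeriv, bracketEval, hh, mkDerivation_X, mul_assoc, mul_sub,
    mul_add]
  ring

/-- The polynomial in the brackets that describes a shift in two directions `h`, `s`. -/
def shiftTwo (p h s : V) (a : ℂ) : MvPolynomial (V × V) ℂ :=
  (1 + X (p - a • 1, s * h)) * (1 - X (1, h)) + X (1, s * h) * X (p - a • 1, h)

theorem bracket_resolvent {q s h : V} {a a' : ℂ} (hh : q * h = 1 - a • h)
    (hs : q * s = 1 - a' • s) (f : V) : b f s = b f h + (a - a') * b f (s * h) := by
  have hs' : s = h + (a - a') • (s * h) := by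
    have : q * s * h = s * (q * h) := by ring
    rw [hs, hh] at this
    simp only [sub_mul, mul_sub, one_mul, mul_one, smul_mul_assoc, mul_smul_comm] at this
    rw [sub_smul]
    linear_combination (exp := 1) -this
  conv_lhs => rw [hs']
  simp

theorem hirotaForm_mixed {p q r s h : V} {a a' : ℂ} (hh : q * h = 1 - a • h)
    (hr : p * r = 1 + a' • r) (hs : q * s = 1 - a' • s) :
    hirotaForm (bracketEval b) [covW r s, covX p q, covX p q] (1 - X (1, h)) 1
      - hirotaForm (bracketEval b) [covW r s, covY p q] (1 - X (1, h)) 1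
      + 2 * a * hirotaForm (bracketEval b) [covW r s, covX p q] (1 - X (1, h)) 1
      - 4 * (hirotaForm (bracketEval b) [covX p q] (1 - X (1, h)) 1
        + (a - a') * bracketEval b (1 - X (1, h)))
      + 4 * (a - a') * (bracketEval b (shiftTwo p h s a) * bracketEval b (1 - X (r, 1))) = 0 := by
  have hsh : q * (s * h) = s - a • (s * h) := by
    rw [mul_left_comm, hh]; simp [mul_sub]
  simp [hirotaForm, covDeriv, bracketDeriv, bracketEval, hh, hr, hs, hsh, mkDerivation_X,
    mul_assoc, mul_sub, mul_add, shiftTwo]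
  simp only [bracket_resolvent b hh hs]
  ring

theorem hirotaForm_shift {p q s h : V} {a a' : ℂ} (hh : q * h = 1 - a • h)
    (hs : q * s = 1 - a' • s) :
    hirotaForm (bracketEval b) [covX p q] (1 - X (1, h)) (1 - X (1, s))
      + (a - a') * (bracketEval b (1 - X (1, h)) * bracketEval b (1 - X (1, s)))
      = (a - a') * bracketEval b (shiftTwo p h s a) := by
  simp [hirotaForm, covDeriv, bracketDeriv, bracketEval, hh, hs, mkDerivation_X, shiftTwo]
  simp only [bracket_resolvent b hh hs]
  ring

end Algebra

section Calculus

variable {K : ℕ}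

/-- `F` has partial derivative `F'` at `z` in coordinate `j`. -/
def HasPD (j : Fin K) (F : (Fin K → ℝ) → ℂ) (F' : ℂ) (z : Fin K → ℝ) : Prop :=
  HasDerivAt (fun s : ℝ => F (Function.update z j s)) F' (z j)

theorem HasPD.pd_eq {j : Fin K} {F : (Fin K → ℝ) → ℂ} {F' : ℂ} {z : Fin K → ℝ}
    (h : HasPD j F F' z) : pd j F z = F' :=
  HasDerivAt.deriv h

theorem HasPD.mul {j : Fin K} {F G : (Fin K → ℝ) → ℂ} {F' G' : ℂ} {z : Fin K → ℝ}
    (hF : HasPD j F F' z) (hG : HasPD j G G' z) :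
    HasPD j (fun z => F z * G z) (F' * G z + F z * G') z := by
  simpa [HasPD] using HasDerivAt.fun_mul hF hG

theorem HasPD.add {j : Fin K} {F G : (Fin K → ℝ) → ℂ} {F' G' : ℂ} {z : Fin K → ℝ}
    (hF : HasPD j F F' z) (hG : HasPD j G G' z) :
    HasPD j (fun z => F z + G z) (F' + G') z :=
  HasDerivAt.fun_add hF hG

theorem HasPD.sub {j : Fin K} {F G : (Fin K → ℝ) → ℂ} {F' G' : ℂ} {z : Fin K → ℝ}
    (hF : HasPD j F F' z) (hG : HasPD j G G' z) :
    HasPD j (fun z => F z - G z) (F' - G') z :=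
  HasDerivAt.fun_sub hF hG

theorem HasPD.sum {ι : Type*} (s : Finset ι) {j : Fin K} {F : ι → (Fin K → ℝ) → ℂ} {F' : ι → ℂ}
    {z : Fin K → ℝ} (hF : ∀ i ∈ s, HasPD j (F i) (F' i) z) :
    HasPD j (fun z => ∑ i ∈ s, F i z) (∑ i ∈ s, F' i) z :=
  HasDerivAt.fun_sum hF

theorem hasPD_const (j : Fin K) (c : ℂ) (z : Fin K → ℝ) : HasPD j (fun _ => c) 0 z :=
  hasDerivAt_const _ _

theorem hasPD_coord (j i : Fin K) (z : Fin K → ℝ) :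
    HasPD j (fun z => (z i : ℂ)) (if i = j then 1 else 0) z := by
  by_cases h : i = j
  · subst h
    simpa [HasPD] using (hasDerivAt_id (z i)).ofReal_comp
  · simpa [HasPD, h] using hasDerivAt_const (z j) ((z i : ℝ) : ℂ)

theorem HasPD.cexp {j : Fin K} {F : (Fin K → ℝ) → ℂ} {F' : ℂ} {z : Fin K → ℝ}
    (hF : HasPD j F F' z) : HasPD j (fun z => cexp (F z)) (cexp (F z) * F') z := by
  simpa [HasPD] using HasDerivAt.cexp hF

theorem HasPD.comp_add {j : Fin K} {F : (Fin K → ℝ) → ℂ} {F' : ℂ} {z s : Fin K → ℝ}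
    (hF : HasPD j F F' (z + s)) : HasPD j (fun s => F (z + s)) F' s := by
  have h := HasDerivAt.comp_const_add (z j) (s j) hF
  refine h.congr_of_eventuallyEq (.of_forall fun t => ?_)
  refine congrArg F (funext fun i => ?_)
  by_cases h : i = j
  · subst h; simp
  · simp [h]

theorem HasPD.comp_sub {j : Fin K} {F : (Fin K → ℝ) → ℂ} {F' : ℂ} {z s : Fin K → ℝ}
    (hF : HasPD j F F' (z - s)) : HasPD j (fun s => F (z - s)) (-F') s := by
  have h := HasDerivAt.comp_const_sub (z j) (s j) hF
  refine h.congr_of_eventuallyEq (.of_forall fun t => ?_)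
  refine congrArg F (funext fun i => ?_)
  by_cases h : i = j
  · subst h; simp
  · simp [h]

theorem tendsto_update (j : Fin K) (z : Fin K → ℝ) :
    Filter.Tendsto (fun s : ℝ => Function.update z j s) (nhds (z j)) (nhds z) := by
  have : Continuous fun s : ℝ => Function.update z j s :=
    continuous_const.update j continuous_id
  simpa using this.tendsto (z j)

theorem Set.EqOn.pd {j : Fin K} {F G : (Fin K → ℝ) → ℂ} {U : Set (Fin K → ℝ)} (hU : IsOpen U)
    (h : Set.EqOn F G U) : Set.EqOn (pd j F) (pd j G) U := by
  intro z hz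
  refine Filter.EventuallyEq.deriv_eq ?_
  filter_upwards [(tendsto_update j z).eventually (hU.mem_nhds hz)] with s hs using h hs

/-- On `U`, the operator `d` on `R` represents `P ↦ τ⁻¹ ∂_j (τ P)`, elements of `R` being
functions by means of `e`. -/
def Represents {R : Type*} (U : Set (Fin K → ℝ)) (τ : (Fin K → ℝ) → ℂ)
    (e : (Fin K → ℝ) → R → ℂ) (j : Fin K) (d : R → R) : Prop :=
  ∀ P, ∀ z ∈ U, HasPD j (fun z => τ z * e z P) (τ z * e z (d P)) z

section Hirota

variable {R : Type*} {U : Set (Fin K → ℝ)} {τ : (Fin K → ℝ) → ℂ} {e : (Fin K → ℝ) → R → ℂ}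
  {j j₁ j₂ j₃ : Fin K} {d d₁ d₂ d₃ : R → R}

/-- Shifts `s` for which both `z + s` and `z - s` lie in `U`. -/
def symmShifts (U : Set (Fin K → ℝ)) (z : Fin K → ℝ) : Set (Fin K → ℝ) :=
  {s | z + s ∈ U ∧ z - s ∈ U}

theorem isOpen_symmShifts (hU : IsOpen U) (z : Fin K → ℝ) : IsOpen (symmShifts U z) :=
  (hU.preimage (by fun_prop : Continuous fun s => z + s)).inter
    (hU.preimage (by fun_prop : Continuous fun s => z - s))

/-- The product `(τ P)(z + s) (τ Q)(z - s)`. -/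
def shiftProd (τ : (Fin K → ℝ) → ℂ) (e : (Fin K → ℝ) → R → ℂ) (z : Fin K → ℝ) (P Q : R)
    (s : Fin K → ℝ) : ℂ :=
  (τ (z + s) * e (z + s) P) * (τ (z - s) * e (z - s) Q)

theorem Represents.hasPD_shiftProd (h : Represents U τ e j d) (z : Fin K → ℝ) (P Q : R)
    {s : Fin K → ℝ} (hs : s ∈ symmShifts U z) :
    HasPD j (shiftProd τ e z P Q) (shiftProd τ e z (d P) Q s - shiftProd τ e z P (d Q) s) s := by
  convert (h P _ hs.1).comp_add.mul (h Q _ hs.2).comp_sub using 1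
  · rfl
  · simp only [shiftProd]; ring

variable {a b : (Fin K → ℝ) → ℂ} {P Q : R} {z : Fin K → ℝ}

theorem eqOn_shiftProd (ha : Set.EqOn a (fun z => τ z * e z P) U)
    (hb : Set.EqOn b (fun z => τ z * e z Q) U) :
    Set.EqOn (fun s => a (z + s) * b (z - s)) (shiftProd τ e z P Q) (symmShifts U z) :=
  fun s hs => by simp only [shiftProd]; rw [ha hs.1, hb hs.2]

theorem Represents.eqOn_pd (h : Represents U τ e j d) (z : Fin K → ℝ) (P Q : R) :
    Set.EqOn (pd j (shiftProd τ e z P Q))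
      (fun s => shiftProd τ e z (d P) Q s - shiftProd τ e z P (d Q) s) (symmShifts U z) :=
  fun _ hs => (h.hasPD_shiftProd z P Q hs).pd_eq

theorem zero_mem_symmShifts (hz : z ∈ U) : (0 : Fin K → ℝ) ∈ symmShifts U z := by
  simpa [symmShifts] using hz

theorem pd_eq_hirotaForm (hU : IsOpen U) (hz : z ∈ U) (h : Represents U τ e j d)
    (ha : Set.EqOn a (fun z => τ z * e z P) U) (hb : Set.EqOn b (fun z => τ z * e z Q) U) :
    pd j (fun s => a (z + s) * b (z - s)) 0 = τ z ^ 2 * hirotaForm (e z) [d] P Q := by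
  rw [(eqOn_shiftProd ha hb).pd (isOpen_symmShifts hU z) (zero_mem_symmShifts hz),
    h.eqOn_pd z P Q (zero_mem_symmShifts hz)]
  simp only [shiftProd, hirotaForm, add_zero, sub_zero]
  ring

theorem Represents.eqOn_pd_pd (hU : IsOpen U) (h₁ : Represents U τ e j₁ d₁)
    (h₂ : Represents U τ e j₂ d₂) (z : Fin K → ℝ) (P Q : R) :
    Set.EqOn (pd j₂ (pd j₁ (shiftProd τ e z P Q)))
      (fun s => (shiftProd τ e z (d₂ (d₁ P)) Q s - shiftProd τ e z (d₁ P) (d₂ Q) s)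
        - (shiftProd τ e z (d₂ P) (d₁ Q) s - shiftProd τ e z P (d₂ (d₁ Q)) s))
      (symmShifts U z) := fun s hs => by
  rw [(h₁.eqOn_pd z P Q).pd (isOpen_symmShifts hU z) hs]
  exact ((h₂.hasPD_shiftProd z _ _ hs).sub (h₂.hasPD_shiftProd z _ _ hs)).pd_eq

theorem pd_pd_eq_hirotaForm (hU : IsOpen U) (hz : z ∈ U) (h₁ : Represents U τ e j₁ d₁)
    (h₂ : Represents U τ e j₂ d₂)
    (ha : Set.EqOn a (fun z => τ z * e z P) U) (hb : Set.EqOn b (fun z => τ z * e z Q) U) :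
    pd j₂ (pd j₁ (fun s => a (z + s) * b (z - s))) 0
      = τ z ^ 2 * hirotaForm (e z) [d₁, d₂] P Q := by
  have hV := isOpen_symmShifts hU z
  rw [((eqOn_shiftProd ha hb).pd hV).pd hV (zero_mem_symmShifts hz),
    h₁.eqOn_pd_pd hU h₂ z P Q (zero_mem_symmShifts hz)]
  simp only [shiftProd, hirotaForm, add_zero, sub_zero]
  ring

theorem pd_pd_pd_eq_hirotaForm (hU : IsOpen U) (hz : z ∈ U) (h₁ : Represents U τ e j₁ d₁)
    (h₂ : Represents U τ e j₂ d₂) (h₃ : Represents U τ e j₃ d₃)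
    (ha : Set.EqOn a (fun z => τ z * e z P) U) (hb : Set.EqOn b (fun z => τ z * e z Q) U) :
    pd j₃ (pd j₂ (pd j₁ (fun s => a (z + s) * b (z - s)))) 0
      = τ z ^ 2 * hirotaForm (e z) [d₁, d₂, d₃] P Q := by
  have hV := isOpen_symmShifts hU z
  have h0 := zero_mem_symmShifts hz
  rw [(((eqOn_shiftProd ha hb).pd hV).pd hV).pd hV h0, (h₁.eqOn_pd_pd hU h₂ z P Q).pd hV h0,
    (((h₃.hasPD_shiftProd z _ _ h0).sub (h₃.hasPD_shiftProd z _ _ h0)).sub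
      ((h₃.hasPD_shiftProd z _ _ h0).sub (h₃.hasPD_shiftProd z _ _ h0))).pd_eq]
  simp only [shiftProd, hirotaForm, add_zero, sub_zero]
  ring

end Hirota

section Matrix

open Matrix

variable {N : ℕ}

theorem hasDerivAt_det {B : ℝ → Matrix (Fin N) (Fin N) ℂ} {B' : Matrix (Fin N) (Fin N) ℂ} {t : ℝ}
    (hB : ∀ i l, HasDerivAt (fun s => B s i l) (B' i l) t) (ht : (B t).det ≠ 0) :
    HasDerivAt (fun s => (B s).det) ((B t).det * ((B t)⁻¹ * B').trace) t := by
  have h : HasDerivAt (fun s => (B s).det) (∑ i, ((B t).updateCol i fun l => B' l i).det) t := by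
    simp only [det_apply]
    rw [Finset.sum_comm]
    refine HasDerivAt.fun_sum fun σ _ => ?_
    have := (HasDerivAt.fun_finsetProd (u := Finset.univ) (fun i _ => hB (σ i) i)).const_smul
      (Equiv.Perm.sign σ : ℤ)
    rw [Finset.smul_sum] at this
    refine this.congr_deriv (Finset.sum_congr rfl fun i _ => ?_)
    rw [← Finset.mul_prod_erase _ _ (Finset.mem_univ i), smul_eq_mul, mul_comm,
      updateCol_self]
    congr 2
    exact Finset.prod_congr rfl fun l hl => by rw [updateCol_ne (Finset.ne_of_mem_erase hl)]
  convert h using 1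
  have h1 : (B t).det • (B t)⁻¹ = (B t).adjugate := by
    rw [Matrix.inv_def, smul_smul, Ring.mul_inverse_cancel _ (isUnit_iff_ne_zero.2 ht), one_smul]
  rw [← smul_eq_mul, ← Matrix.trace_smul, ← smul_mul_assoc, h1]
  simp only [trace, diag_apply]
  refine Finset.sum_congr rfl fun i _ => ?_
  rw [← cramer_apply, cramer_eq_adjugate_mulVec]
  rfl

theorem hasDerivAt_matrix_inv {B : ℝ → Matrix (Fin N) (Fin N) ℂ} {B' : Matrix (Fin N) (Fin N) ℂ}
    {t : ℝ} (hB : ∀ i l, HasDerivAt (fun s => B s i l) (B' i l) t) (ht : (B t).det ≠ 0)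
    (i l : Fin N) :
    HasDerivAt (fun s => (B s)⁻¹ i l) ((-((B t)⁻¹ * B' * (B t)⁻¹)) i l) t := by
  have hcont : ContinuousAt B t :=
    continuousAt_pi.2 fun i => continuousAt_pi.2 fun l => (hB i l).continuousAt
  have hinv : Filter.Tendsto (fun s => (B s)⁻¹) (nhds t) (nhds (B t)⁻¹) := by
    refine ContinuousAt.comp (f := B) (g := fun M => M⁻¹) ?_ hcont
    refine continuousAt_matrix_inv _ ?_
    exact NormedRing.inverse_continuousAt (Units.mk0 _ ht)
  have hslope : Filter.Tendsto (fun s => (s - t)⁻¹ • (B s - B t)) (nhdsWithin t {t}ᶜ)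
      (nhds B') := by
    refine tendsto_pi_nhds.2 fun i => tendsto_pi_nhds.2 fun l => ?_
    exact hasDerivAt_iff_tendsto_slope.1 (hB i l)
  rw [hasDerivAt_iff_tendsto_slope]
  have hlim : Filter.Tendsto (fun s => -((B s)⁻¹ * ((s - t)⁻¹ • (B s - B t)) * (B t)⁻¹))
      (nhdsWithin t {t}ᶜ) (nhds (-((B t)⁻¹ * B' * (B t)⁻¹))) :=
    (((hinv.mono_left nhdsWithin_le_nhds).mul hslope).mul tendsto_const_nhds).neg
  refine ((hlim.apply_nhds i).apply_nhds l).congr' ?_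
  have hne : ∀ᶠ s in nhds t, (B s).det ≠ 0 :=
    ((continuous_id.matrix_det.tendsto (B t)).comp hcont).eventually_ne ht
  filter_upwards [nhdsWithin_le_nhds hne] with s hs
  have hid : -((B s)⁻¹ * ((s - t)⁻¹ • (B s - B t)) * (B t)⁻¹)
      = (s - t)⁻¹ • ((B s)⁻¹ - (B t)⁻¹) := by
    rw [mul_smul_comm, smul_mul_assoc, ← smul_neg, mul_sub, sub_mul,
      nonsing_inv_mul _ (isUnit_iff_ne_zero.2 hs), one_mul, mul_assoc,
      mul_nonsing_inv _ (isUnit_iff_ne_zero.2 ht), mul_one, neg_sub]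
  exact congrFun (congrFun hid i) l

end Matrix

section Gram

open Matrix MvPolynomial

variable {K N : ℕ} (c : Fin N → Fin N → ℂ) (p q : Fin N → ℂ)
  (φ ψ : Fin N → (Fin K → ℝ) → ℂ)

/-- The matrix `c i l + φ i ψ l / (p i + q l)`. -/
def gramMatrix (z : Fin K → ℝ) : Matrix (Fin N) (Fin N) ℂ :=
  Matrix.of fun i l => c i l + φ i z * ψ l z / (p i + q l)

/-- The bracket `⟨f, g⟩ = ∑ (f i φ i) G l i (g l ψ l)` with `G` the inverse of the Gram matrix. -/
def bracket (z : Fin K → ℝ) : (Fin N → ℂ) →ₗ[ℂ] (Fin N → ℂ) →ₗ[ℂ] ℂ :=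
  Matrix.toLinearMap₂' ℂ
    (Matrix.of fun i l => φ i z * (gramMatrix c p q φ ψ z)⁻¹ l i * ψ l z)

theorem bracket_apply (z : Fin K → ℝ) (f g : Fin N → ℂ) :
    bracket c p q φ ψ z f g
      = ∑ i, ∑ l, f i * φ i z * ((gramMatrix c p q φ ψ z)⁻¹ l i * (g l * ψ l z)) := by
  simp only [bracket, Matrix.toLinearMap₂'_apply, smul_eq_mul, of_apply]
  refine Finset.sum_congr rfl fun i _ => Finset.sum_congr rfl fun l _ => ?_
  ring

theorem bracket_eq_dotProduct (z : Fin K → ℝ) (f g : Fin N → ℂ) :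
    bracket c p q φ ψ z f g
      = (fun l => g l * ψ l z) ⬝ᵥ (gramMatrix c p q φ ψ z)⁻¹ *ᵥ fun i => f i * φ i z := by
  rw [bracket_apply, Finset.sum_comm]
  simp only [dotProduct, mulVec, Finset.mul_sum]
  refine Finset.sum_congr rfl fun i _ => Finset.sum_congr rfl fun l _ => ?_
  ring

variable {c p q φ ψ} {j : Fin K} {z : Fin K → ℝ} {α β : Fin N → ℂ}
  {L : List ((Fin N → ℂ) × (Fin N → ℂ))}

theorem hasPD_gramMatrix (hpq : ∀ i l, p i + q l ≠ 0)
    (hφ : ∀ i, HasPD j (φ i) (α i * φ i z) z) (hψ : ∀ l, HasPD j (ψ l) (β l * ψ l z) z)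
    (hL : ∀ i l, α i + β l = (p i + q l) * (L.map fun r => r.1 i * r.2 l).sum) (i l : Fin N) :
    HasPD j (fun z => gramMatrix c p q φ ψ z i l)
      ((L.map fun r => vecMulVec (fun i => r.1 i * φ i z) fun l => r.2 l * ψ l z).sum i l) z := by
  have h := (hasPD_const j (c i l) z).add (((hφ i).mul (hψ l)).mul (hasPD_const j (p i + q l)⁻¹ z))
  simp only [← div_eq_mul_inv] at h
  change HasPD j (fun z => c i l + φ i z * ψ l z / (p i + q l)) _ z
  convert h using 1
  have hsum : (L.map fun r => vecMulVec (fun i => r.1 i * φ i z) fun l => r.2 l * ψ l z).sum i l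
      = (L.map fun r => r.1 i * r.2 l).sum * (φ i z * ψ l z) := by
    clear hL
    induction L with
    | nil => simp
    | cons r L ih =>
      simp only [List.map_cons, List.sum_cons, Matrix.add_apply, ih, vecMulVec_apply]
      ring
  have hpql := hpq i l
  rw [hsum]
  have e : α i * φ i z * ψ l z + φ i z * (β l * ψ l z)
      = (p i + q l) * ((L.map fun r => r.1 i * r.2 l).sum * (φ i z * ψ l z)) := by
    rw [← mul_assoc (p i + q l), ← hL]; ring
  rw [e]
  field_simp
  ring

theorem trace_inv_mul_sum (L : List ((Fin N → ℂ) × (Fin N → ℂ))) (z : Fin K → ℝ) :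
    ((gramMatrix c p q φ ψ z)⁻¹ *
      (L.map fun r => vecMulVec (fun i => r.1 i * φ i z) fun l => r.2 l * ψ l z).sum).trace
      = (L.map fun r => bracket c p q φ ψ z r.1 r.2).sum := by
  induction L with
  | nil => simp
  | cons r L ih =>
    rw [List.map_cons, List.sum_cons, mul_add, trace_add, ih, mul_vecMulVec, trace_vecMulVec,
      dotProduct_comm, ← bracket_eq_dotProduct, List.map_cons, List.sum_cons]

theorem dotProduct_inv_mul_sum_mul_inv (L : List ((Fin N → ℂ) × (Fin N → ℂ)))
    (z : Fin K → ℝ) (f g : Fin N → ℂ) :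
    (fun l => g l * ψ l z) ⬝ᵥ ((gramMatrix c p q φ ψ z)⁻¹ *
      (L.map fun r => vecMulVec (fun i => r.1 i * φ i z) fun l => r.2 l * ψ l z).sum *
        (gramMatrix c p q φ ψ z)⁻¹) *ᵥ (fun i => f i * φ i z)
      = (L.map fun r => bracket c p q φ ψ z r.1 g * bracket c p q φ ψ z f r.2).sum := by
  induction L with
  | nil => simp
  | cons r L ih =>
    rw [List.map_cons, List.sum_cons, mul_add, add_mul, add_mulVec, dotProduct_add, ih,
      mul_vecMulVec, ← mulVec_mulVec, vecMulVec_mulVec, List.map_cons, List.sum_cons,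
      bracket_eq_dotProduct, bracket_eq_dotProduct]
    simp [mul_comm]

theorem hasPD_bracket (hpq : ∀ i l, p i + q l ≠ 0)
    (hφ : ∀ i, HasPD j (φ i) (α i * φ i z) z) (hψ : ∀ l, HasPD j (ψ l) (β l * ψ l z) z)
    (hL : ∀ i l, α i + β l = (p i + q l) * (L.map fun r => r.1 i * r.2 l).sum)
    (hz : (gramMatrix c p q φ ψ z).det ≠ 0) (f g : Fin N → ℂ) :
    HasPD j (fun z => bracket c p q φ ψ z f g)
      (bracket c p q φ ψ z (α * f) g + bracket c p q φ ψ z f (β * g)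
        - (L.map fun r => bracket c p q φ ψ z r.1 g * bracket c p q φ ψ z f r.2).sum) z := by
  simp only [bracket_apply c p q φ ψ _ f g]
  have hA := hasPD_gramMatrix (c := c) hpq hφ hψ hL
  have hG : ∀ i l, HasPD j (fun z => (gramMatrix c p q φ ψ z)⁻¹ i l) _ z := fun i l =>
    hasDerivAt_matrix_inv (B := fun s => gramMatrix c p q φ ψ (Function.update z j s))
      (t := z j) hA (by simpa using hz) i l
  have h := HasPD.sum Finset.univ fun i _ => HasPD.sum Finset.univ fun l _ =>
    ((hasPD_const j (f i) z).mul (hφ i)).mul ((hG l i).mul ((hasPD_const j (g l) z).mul (hψ l)))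
  convert h using 1
  rw [← dotProduct_inv_mul_sum_mul_inv, bracket_apply, bracket_apply]
  simp only [dotProduct, mulVec, Finset.mul_sum, Function.update_eq_self, Pi.mul_apply]
  rw [Finset.sum_comm (f := fun l i => g l * ψ l z * _)]
  simp only [← Finset.sum_add_distrib, ← Finset.sum_sub_distrib]
  refine Finset.sum_congr rfl fun i _ => Finset.sum_congr rfl fun l _ => ?_
  simp only [Matrix.neg_apply]
  ring

theorem hasPD_bracketEval (hpq : ∀ i l, p i + q l ≠ 0)
    (hφ : ∀ i, HasPD j (φ i) (α i * φ i z) z) (hψ : ∀ l, HasPD j (ψ l) (β l * ψ l z) z)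
    (hL : ∀ i l, α i + β l = (p i + q l) * (L.map fun r => r.1 i * r.2 l).sum)
    (hz : (gramMatrix c p q φ ψ z).det ≠ 0)
    (P : MvPolynomial ((Fin N → ℂ) × (Fin N → ℂ)) ℂ) :
    HasPD j (fun z => bracketEval (bracket c p q φ ψ z) P)
      (bracketEval (bracket c p q φ ψ z) (bracketDeriv α β L P)) z := by
  induction P using MvPolynomial.induction_on with
  | C a => simpa [bracketEval, bracketDeriv] using hasPD_const j a z
  | add P Q hP hQ => simpa using hP.add hQ
  | mul_X P x hP =>
    have hx := hP.mul (hasPD_bracket hpq hφ hψ hL hz x.1 x.2)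
    have hs : bracketEval (bracket c p q φ ψ z) (bracketDeriv α β L (X x))
        = bracket c p q φ ψ z (α * x.1) x.2 + bracket c p q φ ψ z x.1 (β * x.2)
        - (L.map fun r => bracket c p q φ ψ z r.1 x.2 * bracket c p q φ ψ z x.1 r.2).sum := by
      simp [bracketEval, bracketDeriv, mkDerivation_X, map_list_sum, Function.comp_def]
    have hX : ∀ z, bracketEval (bracket c p q φ ψ z) (X x) = bracket c p q φ ψ z x.1 x.2 :=
      fun z => by simp [bracketEval]
    rw [← hs] at hx
    simp only [map_mul, hX, Derivation.leibniz, map_add, smul_eq_mul]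
    convert hx using 1
    ring

theorem represents_covDeriv (hpq : ∀ i l, p i + q l ≠ 0)
    (hφ : ∀ z i, HasPD j (φ i) (α i * φ i z) z) (hψ : ∀ z l, HasPD j (ψ l) (β l * ψ l z) z)
    (hL : ∀ i l, α i + β l = (p i + q l) * (L.map fun r => r.1 i * r.2 l).sum) :
    Represents {z | (gramMatrix c p q φ ψ z).det ≠ 0} (fun z => (gramMatrix c p q φ ψ z).det)
      (fun z => bracketEval (bracket c p q φ ψ z)) j (covDeriv α β L) := by
  intro P z hz
  have hτ : HasPD j (fun z => (gramMatrix c p q φ ψ z).det) _ z :=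
    hasDerivAt_det (B := fun s => gramMatrix c p q φ ψ (Function.update z j s))
      (t := z j) (hasPD_gramMatrix (c := c) hpq (hφ z) (hψ z) hL) (by simpa using hz)
  convert hτ.mul (hasPD_bracketEval hpq (hφ z) (hψ z) hL hz P) using 1
  simp only [Function.update_eq_self, trace_inv_mul_sum]
  simp only [covDeriv, map_add, map_mul, map_list_sum, List.map_map]
  simp only [bracketEval, Function.comp_def, aeval_X]
  ring

end Gram

section Shift

open Matrix MvPolynomial

theorem det_add_vecMulVec_add_vecMulVec {N : ℕ} (A : Matrix (Fin N) (Fin N) ℂ) (hA : A.det ≠ 0)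
    (u v u' v' : Fin N → ℂ) :
    (A + (vecMulVec u v + vecMulVec u' v')).det
      = A.det * ((1 + v ⬝ᵥ A⁻¹ *ᵥ u) * (1 + v' ⬝ᵥ A⁻¹ *ᵥ u')
        - (v ⬝ᵥ A⁻¹ *ᵥ u') * (v' ⬝ᵥ A⁻¹ *ᵥ u)) := by
  have h : vecMulVec u v + vecMulVec u' v'
      = (of fun i (e : Fin 2) => ![u i, u' i] e) * (of fun (e : Fin 2) l => ![v l, v' l] e) := by
    ext i l
    simp [mul_apply, Fin.sum_univ_two, vecMulVec_apply]
  rw [h, det_add_mul _ _ (isUnit_iff_ne_zero.2 hA), det_fin_two]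
  congr 1
  have key : ∀ e e' : Fin 2, ((of fun (e : Fin 2) l => ![v l, v' l] e) * A⁻¹ *
      (of fun i (e : Fin 2) => ![u i, u' i] e)) e e'
      = (fun l => ![v l, v' l] e) ⬝ᵥ A⁻¹ *ᵥ fun i => ![u i, u' i] e' := by
    intro e e'
    rw [Matrix.mul_assoc, Matrix.mul_apply]
    rfl
  simp only [Matrix.add_apply, key, Matrix.one_apply]
  simp

theorem det_add_vecMulVec {N : ℕ} (A : Matrix (Fin N) (Fin N) ℂ) (hA : A.det ≠ 0)
    (u v : Fin N → ℂ) : (A + vecMulVec u v).det = A.det * (1 + v ⬝ᵥ A⁻¹ *ᵥ u) := by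
  simpa using det_add_vecMulVec_add_vecMulVec A hA u v 0 0

variable {K N : ℕ} {c : Fin N → Fin N → ℂ} {p q : Fin N → ℂ}
  {φ ψ : Fin N → (Fin K → ℝ) → ℂ} {z : Fin K → ℝ}

theorem det_gramMatrix_add (hz : (gramMatrix c p q φ ψ z).det ≠ 0) (f g : Fin N → ℂ)
    {B : Matrix (Fin N) (Fin N) ℂ}
    (hB : ∀ i l, B i l = gramMatrix c p q φ ψ z i l - f i * g l * (φ i z * ψ l z)) :
    B.det = (gramMatrix c p q φ ψ z).det *
      bracketEval (bracket c p q φ ψ z) (1 - X (f, g)) := by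
  have h : B = gramMatrix c p q φ ψ z
      + vecMulVec (fun i => (-f) i * φ i z) (fun l => g l * ψ l z) := by
    ext i l
    rw [hB, Matrix.add_apply, vecMulVec_apply, Pi.neg_apply]
    ring
  rw [h, det_add_vecMulVec _ hz, ← bracket_eq_dotProduct]
  simp [bracketEval, sub_eq_add_neg]

theorem det_gramMatrix_shiftTwo (hz : (gramMatrix c p q φ ψ z).det ≠ 0) (h s : Fin N → ℂ) (a : ℂ)
    {B : Matrix (Fin N) (Fin N) ℂ}
    (hB : ∀ i l, B i l = gramMatrix c p q φ ψ z i l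
      + ((p i - a) * (s l * h l) - h l) * (φ i z * ψ l z)) :
    B.det = (gramMatrix c p q φ ψ z).det *
      bracketEval (bracket c p q φ ψ z) (shiftTwo p h s a) := by
  have e : B = gramMatrix c p q φ ψ z
      + (vecMulVec (fun i => (p - a • 1) i * φ i z) (fun l => (s * h) l * ψ l z)
        + vecMulVec (fun i => (-1 : Fin N → ℂ) i * φ i z) (fun l => h l * ψ l z)) := by
    ext i l
    rw [hB, Matrix.add_apply, Matrix.add_apply, vecMulVec_apply, vecMulVec_apply]
    simp
    ring
  rw [e, det_add_vecMulVec_add_vecMulVec _ hz]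
  simp only [← bracket_eq_dotProduct]
  simp [bracketEval, shiftTwo, sub_eq_add_neg]

end Shift

end Calculus

section Coordinates

theorem foldr_iterate_eq {ι α : Type*} (f : ι → α → α) (m : ι → ℕ) {l : ι} {L : List ι}
    (hL : L.Nodup) (hl : l ∈ L) (hm : ∀ n, n ≠ l → m n = 0) (x : α) :
    L.foldr (fun n y => (f n)^[m n] y) x = (f l)^[m l] x := by
  have hzero : ∀ L : List ι, l ∉ L → L.foldr (fun n y => (f n)^[m n] y) x = x := by
    intro L
    induction L with
    | nil => simp
    | cons n L ih =>
      intro h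
      rw [List.mem_cons, not_or] at h
      rw [List.foldr_cons, ih h.2, hm n (Ne.symm h.1), Function.iterate_zero, id]
  induction L with
  | nil => simp at hl
  | cons n L ih =>
    rw [List.nodup_cons] at hL
    rw [List.foldr_cons]
    by_cases h : n = l
    · subst h
      rw [hzero L hL.1]
    · rw [ih hL.2 ((List.mem_cons.1 hl).resolve_left (Ne.symm h)), hm n h,
        Function.iterate_zero, id]

/-- The coordinates `x`, `y`, `t`. -/
abbrev coord {M : ℕ} (i : Fin 3) : Fin (M + 3) := ⟨i, by omega⟩

/-- The coordinate of negative weight with index `n`. -/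
abbrev negCoord {M : ℕ} (n : Fin M) : Fin (M + 3) := ⟨n + 3, by omega⟩

theorem mixedPD_eq {M : ℕ} (m : Fin (M + 3) → ℕ) (l : Fin M) (F : (Fin (M + 3) → ℝ) → ℂ)
    (hm : ∀ n, n ≠ l → m (negCoord n) = 0) :
    mixedPD m F = (pd (coord 0))^[m (coord 0)] ((pd (coord 1))^[m (coord 1)]
      ((pd (coord 2))^[m (coord 2)] ((pd (negCoord l))^[m (negCoord l)] F))) := by
  rw [← foldr_iterate_eq (fun n => pd (negCoord n)) (fun n => m (negCoord n))
    (List.nodup_finRange M) (List.mem_finRange l) hm]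
  unfold mixedPD
  simp only [List.finRange_succ, List.foldr_cons, List.foldr_map, List.map_cons]
  rfl

end Coordinates

section Tau

variable {M N : ℕ}

/-- The dark Gram tau function. -/
def darkTau (c : Fin N → Fin N → ℂ) (p q ξ₀ η₀ : Fin N → ℂ) (a : Fin M → ℂ) (nn : Fin M → ℤ)
    (z : Fin (M + 3) → ℝ) : ℂ :=
  (Matrix.of fun i j => c i j + Complex.exp (
      (p i * (z (coord 0) : ℂ) + p i ^ 2 * (z (coord 1) : ℂ) + p i ^ 3 * (z (coord 2) : ℂ)
        + (∑ n, (z (negCoord n) : ℂ) / (p i - a n)) + ξ₀ i)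
      + (q j * (z (coord 0) : ℂ) - q j ^ 2 * (z (coord 1) : ℂ) + q j ^ 3 * (z (coord 2) : ℂ)
        + (∑ n, (z (negCoord n) : ℂ) / (q j + a n)) + η₀ j)) / (p i + q j)
    * ∏ n, (-((p i - a n) / (q j + a n))) ^ (nn n)).det

/-- The KP–Toda bilinear identities at a point. -/
def KPToda (a : Fin M → ℂ) (τ : (Fin M → ℤ) → (Fin (M + 3) → ℝ) → ℂ) (k l : Fin M)
    (nn : Fin M → ℤ) (z : Fin (M + 3) → ℝ) : Prop :=
  (Hirota (Pi.single (negCoord k) 1 + Pi.single (coord 0) 1) (τ nn) (τ nn) z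
      - 2 * (τ nn z * τ nn z)
    = -2 * τ (nn + Pi.single k 1) z * τ (nn - Pi.single k 1) z)
  ∧ (Hirota (Pi.single (coord 0) 2) (τ (nn + Pi.single k 1)) (τ nn) z
      - Hirota (Pi.single (coord 1) 1) (τ (nn + Pi.single k 1)) (τ nn) z
      + 2 * a k * Hirota (Pi.single (coord 0) 1) (τ (nn + Pi.single k 1)) (τ nn) z = 0)
  ∧ (Hirota (Pi.single (coord 0) 3) (τ (nn + Pi.single k 1)) (τ nn) z
      + 3 * Hirota (Pi.single (coord 0) 1 + Pi.single (coord 1) 1)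
          (τ (nn + Pi.single k 1)) (τ nn) z
      - 4 * Hirota (Pi.single (coord 2) 1) (τ (nn + Pi.single k 1)) (τ nn) z
      + 3 * a k * (Hirota (Pi.single (coord 0) 2) (τ (nn + Pi.single k 1)) (τ nn) z
          + Hirota (Pi.single (coord 1) 1) (τ (nn + Pi.single k 1)) (τ nn) z)
      + 6 * a k ^ 2 * Hirota (Pi.single (coord 0) 1) (τ (nn + Pi.single k 1)) (τ nn) z = 0)
  ∧ (Hirota (Pi.single (negCoord l) 1 + Pi.single (coord 0) 2) (τ (nn + Pi.single k 1)) (τ nn) z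
      - Hirota (Pi.single (negCoord l) 1 + Pi.single (coord 1) 1)
          (τ (nn + Pi.single k 1)) (τ nn) z
      + 2 * a k * Hirota (Pi.single (negCoord l) 1 + Pi.single (coord 0) 1)
          (τ (nn + Pi.single k 1)) (τ nn) z
      - 4 * (Hirota (Pi.single (coord 0) 1) (τ (nn + Pi.single k 1)) (τ nn) z
          + (a k - a l) * (τ (nn + Pi.single k 1) z * τ nn z))
      + 4 * (a k - a l) * (τ (nn + Pi.single k 1 + Pi.single l 1) z
          * τ (nn - Pi.single l 1) z) = 0)
  ∧ (Hirota (Pi.single (coord 0) 1) (τ (nn + Pi.single k 1)) (τ (nn + Pi.single l 1)) z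
      + (a k - a l) * (τ (nn + Pi.single k 1) z * τ (nn + Pi.single l 1) z)
      = (a k - a l) * (τ (nn + Pi.single k 1 + Pi.single l 1) z * τ nn z))

theorem hirota_x (l : Fin M) (a b : (Fin (M + 3) → ℝ) → ℂ) (z : Fin (M + 3) → ℝ) :
    Hirota (Pi.single (coord 0) 1) a b z
      = pd (coord 0) (fun s => a (z + s) * b (z - s)) 0 := by
  rw [Hirota, mixedPD_eq _ l _ (fun n _ => by simp [Fin.ext_iff])]
  simp [Fin.ext_iff]

theorem hirota_xx (l : Fin M) (a b : (Fin (M + 3) → ℝ) → ℂ) (z : Fin (M + 3) → ℝ) :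
    Hirota (Pi.single (coord 0) 2) a b z
      = pd (coord 0) (pd (coord 0) (fun s => a (z + s) * b (z - s))) 0 := by
  rw [Hirota, mixedPD_eq _ l _ (fun n _ => by simp [Fin.ext_iff])]
  simp [Fin.ext_iff]

theorem hirota_xxx (l : Fin M) (a b : (Fin (M + 3) → ℝ) → ℂ) (z : Fin (M + 3) → ℝ) :
    Hirota (Pi.single (coord 0) 3) a b z
      = pd (coord 0) (pd (coord 0) (pd (coord 0) (fun s => a (z + s) * b (z - s)))) 0 := by
  rw [Hirota, mixedPD_eq _ l _ (fun n _ => by simp [Fin.ext_iff])]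
  simp [Fin.ext_iff]

theorem hirota_y (l : Fin M) (a b : (Fin (M + 3) → ℝ) → ℂ) (z : Fin (M + 3) → ℝ) :
    Hirota (Pi.single (coord 1) 1) a b z
      = pd (coord 1) (fun s => a (z + s) * b (z - s)) 0 := by
  rw [Hirota, mixedPD_eq _ l _ (fun n _ => by simp [Fin.ext_iff])]
  simp [Fin.ext_iff]

theorem hirota_t (l : Fin M) (a b : (Fin (M + 3) → ℝ) → ℂ) (z : Fin (M + 3) → ℝ) :
    Hirota (Pi.single (coord 2) 1) a b z
      = pd (coord 2) (fun s => a (z + s) * b (z - s)) 0 := by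
  rw [Hirota, mixedPD_eq _ l _ (fun n _ => by simp [Fin.ext_iff])]
  simp [Fin.ext_iff]

theorem hirota_x_y (l : Fin M) (a b : (Fin (M + 3) → ℝ) → ℂ) (z : Fin (M + 3) → ℝ) :
    Hirota (Pi.single (coord 0) 1 + Pi.single (coord 1) 1) a b z
      = pd (coord 0) (pd (coord 1) (fun s => a (z + s) * b (z - s))) 0 := by
  rw [Hirota, mixedPD_eq _ l _ (fun n _ => by simp [Fin.ext_iff])]
  simp [Fin.ext_iff]

theorem hirota_w_x (l : Fin M) (a b : (Fin (M + 3) → ℝ) → ℂ) (z : Fin (M + 3) → ℝ) :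
    Hirota (Pi.single (negCoord l) 1 + Pi.single (coord 0) 1) a b z
      = pd (coord 0) (pd (negCoord l) (fun s => a (z + s) * b (z - s))) 0 := by
  rw [Hirota, mixedPD_eq _ l _ (fun n hn => by simp [Fin.ext_iff, Fin.val_inj, hn])]
  simp [Fin.ext_iff]

theorem hirota_w_y (l : Fin M) (a b : (Fin (M + 3) → ℝ) → ℂ) (z : Fin (M + 3) → ℝ) :
    Hirota (Pi.single (negCoord l) 1 + Pi.single (coord 1) 1) a b z
      = pd (coord 1) (pd (negCoord l) (fun s => a (z + s) * b (z - s))) 0 := by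
  rw [Hirota, mixedPD_eq _ l _ (fun n hn => by simp [Fin.ext_iff, Fin.val_inj, hn])]
  simp [Fin.ext_iff]

theorem hirota_w_xx (l : Fin M) (a b : (Fin (M + 3) → ℝ) → ℂ) (z : Fin (M + 3) → ℝ) :
    Hirota (Pi.single (negCoord l) 1 + Pi.single (coord 0) 2) a b z
      = pd (coord 0) (pd (coord 0) (pd (negCoord l) (fun s => a (z + s) * b (z - s)))) 0 := by
  rw [Hirota, mixedPD_eq _ l _ (fun n hn => by simp [Fin.ext_iff, Fin.val_inj, hn])]
  simp [Fin.ext_iff]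

section Generic

variable {c : Fin N → Fin N → ℂ} {p q ξ₀ η₀ : Fin N → ℂ} {a : Fin M → ℂ}

/-- The factor of the Gram matrix entries that depends on the row only. -/
def rowFactor (p ξ₀ : Fin N → ℂ) (a : Fin M → ℂ) (nn : Fin M → ℤ) (i : Fin N)
    (z : Fin (M + 3) → ℝ) : ℂ :=
  Complex.exp (p i * (z (coord 0) : ℂ) + p i ^ 2 * (z (coord 1) : ℂ) + p i ^ 3 * (z (coord 2) : ℂ)
    + (∑ n, (z (negCoord n) : ℂ) / (p i - a n)) + ξ₀ i) * ∏ n, (-(p i - a n)) ^ (nn n)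

/-- The factor of the Gram matrix entries that depends on the column only. -/
def colFactor (q η₀ : Fin N → ℂ) (a : Fin M → ℂ) (nn : Fin M → ℤ) (j : Fin N)
    (z : Fin (M + 3) → ℝ) : ℂ :=
  Complex.exp (q j * (z (coord 0) : ℂ) - q j ^ 2 * (z (coord 1) : ℂ) + q j ^ 3 * (z (coord 2) : ℂ)
    + (∑ n, (z (negCoord n) : ℂ) / (q j + a n)) + η₀ j) * ∏ n, ((q j + a n)⁻¹) ^ (nn n)

theorem hasPD_rowFactor (ξ₀ : Fin N → ℂ) (nn : Fin M → ℤ) (j : Fin (M + 3)) (i : Fin N)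
    (z : Fin (M + 3) → ℝ) :
    HasPD j (rowFactor p ξ₀ a nn i)
      ((p i * (if coord 0 = j then 1 else 0) + p i ^ 2 * (if coord 1 = j then 1 else 0)
        + p i ^ 3 * (if coord 2 = j then 1 else 0)
        + ∑ n, if negCoord n = j then (p i - a n)⁻¹ else 0) * rowFactor p ξ₀ a nn i z) z := by
  have hc : ∀ (d : ℂ) i', HasPD j (fun z : Fin (M + 3) → ℝ => d * (z i' : ℂ)) _ z :=
    fun d i' => (hasPD_const j d z).mul (hasPD_coord j i' z)
  have h := (((((hc (p i) (coord 0)).add (hc (p i ^ 2) (coord 1))).add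
    (hc (p i ^ 3) (coord 2))).add (HasPD.sum Finset.univ fun n _ =>
      hc (p i - a n)⁻¹ (negCoord n))).add (hasPD_const j (ξ₀ i) z)).cexp.mul
    (hasPD_const j (∏ n, (-(p i - a n)) ^ (nn n)) z)
  convert h using 1
  · funext z
    simp only [rowFactor, div_eq_inv_mul]
  · simp only [rowFactor, div_eq_inv_mul, zero_mul, zero_add, mul_ite, mul_one, mul_zero]
    ring

theorem hasPD_colFactor (η₀ : Fin N → ℂ) (nn : Fin M → ℤ) (j : Fin (M + 3)) (i : Fin N)
    (z : Fin (M + 3) → ℝ) :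
    HasPD j (colFactor q η₀ a nn i)
      ((q i * (if coord 0 = j then 1 else 0) - q i ^ 2 * (if coord 1 = j then 1 else 0)
        + q i ^ 3 * (if coord 2 = j then 1 else 0)
        + ∑ n, if negCoord n = j then (q i + a n)⁻¹ else 0) * colFactor q η₀ a nn i z) z := by
  have hc : ∀ (d : ℂ) i', HasPD j (fun z : Fin (M + 3) → ℝ => d * (z i' : ℂ)) _ z :=
    fun d i' => (hasPD_const j d z).mul (hasPD_coord j i' z)
  have h := (((((hc (q i) (coord 0)).sub (hc (q i ^ 2) (coord 1))).add
    (hc (q i ^ 3) (coord 2))).add (HasPD.sum Finset.univ fun n _ =>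
      hc (q i + a n)⁻¹ (negCoord n))).add (hasPD_const j (η₀ i) z)).cexp.mul
    (hasPD_const j (∏ n, ((q i + a n)⁻¹) ^ (nn n)) z)
  convert h using 1
  · funext z
    simp only [colFactor, div_eq_inv_mul]
  · simp only [colFactor, div_eq_inv_mul, zero_mul, zero_add, mul_ite, mul_one, mul_zero]
    ring

theorem prod_zpow_add_single (x : Fin M → ℂ) (hx : ∀ n, x n ≠ 0) (nn : Fin M → ℤ) (k : Fin M)
    (e : ℤ) : ∏ n, x n ^ ((nn + Pi.single k e : Fin M → ℤ) n) = x k ^ e * ∏ n, x n ^ nn n := by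
  have : ∀ n, x n ^ ((nn + Pi.single k e : Fin M → ℤ) n)
      = (if n = k then x k ^ e else 1) * x n ^ nn n := by
    intro n
    rw [Pi.add_apply, zpow_add₀ (hx n), mul_comm]
    by_cases h : n = k
    · subst h; simp
    · simp [h]
  simp only [this, Finset.prod_mul_distrib, Finset.prod_ite_eq', Finset.mem_univ, if_true]

theorem darkTau_eq_det (nn nn' : Fin M → ℤ) (x : Fin N → Fin N → ℂ)
    (hx : ∀ i j, ∏ n, (-((p i - a n) / (q j + a n))) ^ (nn' n)
      = x i j * ∏ n, (-((p i - a n) / (q j + a n))) ^ (nn n)) (z : Fin (M + 3) → ℝ) :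
    darkTau c p q ξ₀ η₀ a nn' z = (Matrix.of fun i j =>
      c i j + rowFactor p ξ₀ a nn i z * colFactor q η₀ a nn j z / (p i + q j) * x i j).det := by
  unfold darkTau
  congr 2
  ext i j
  rw [hx]
  rw [Complex.exp_add (_ + ξ₀ i) (_ + η₀ j), rowFactor, colFactor]
  have : ∏ n, (-((p i - a n) / (q j + a n))) ^ (nn n)
      = (∏ n, (-(p i - a n)) ^ (nn n)) * ∏ n, ((q j + a n)⁻¹) ^ (nn n) := by
    rw [← Finset.prod_mul_distrib]
    refine Finset.prod_congr rfl fun n _ => ?_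
    rw [← mul_zpow, neg_mul, div_eq_mul_inv]
  rw [this]
  ring

theorem kpToda_of_ne_zero (hpq : ∀ i j, p i + q j ≠ 0) (hpa : ∀ i n, p i ≠ a n)
    (hqa : ∀ j n, q j ≠ -a n) (k l : Fin M) (nn : Fin M → ℤ) (z : Fin (M + 3) → ℝ)
    (hz : darkTau c p q ξ₀ η₀ a nn z ≠ 0) :
    KPToda a (darkTau c p q ξ₀ η₀ a) k l nn z := by
  have hpa' : ∀ i n, p i - a n ≠ 0 := fun i n => sub_ne_zero.2 (hpa i n)
  have hqa' : ∀ j n, q j + a n ≠ 0 := fun j n h => hqa j n (eq_neg_of_add_eq_zero_left h)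
  have hxne : ∀ i j n, -((p i - a n) / (q j + a n)) ≠ 0 := fun i j n =>
    neg_ne_zero.2 (div_ne_zero (hpa' i n) (hqa' j n))
  set φ := rowFactor p ξ₀ a nn
  set ψ := colFactor q η₀ a nn
  set T : (Fin (M + 3) → ℝ) → ℂ := fun z => (gramMatrix c p q φ ψ z).det
  set e := fun z => bracketEval (bracket c p q φ ψ z)
  set U : Set (Fin (M + 3) → ℝ) := {z | (gramMatrix c p q φ ψ z).det ≠ 0}
  let r : Fin M → Fin N → ℂ := fun n i => (p i - a n)⁻¹
  let s : Fin M → Fin N → ℂ := fun n j => (q j + a n)⁻¹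
  have hr : ∀ n, p * r n = 1 + a n • r n := fun n => funext fun i => by
    have := hpa' i n
    simp only [r, Pi.mul_apply, Pi.add_apply, Pi.one_apply, Pi.smul_apply, smul_eq_mul]
    field_simp
    ring
  have hs : ∀ n, q * s n = 1 - a n • s n := fun n => funext fun i => by
    have := hqa' i n
    simp only [s, Pi.mul_apply, Pi.sub_apply, Pi.one_apply, Pi.smul_apply, smul_eq_mul]
    field_simp
    ring
  have hτ0 : darkTau c p q ξ₀ η₀ a nn = T := funext fun z => by
    rw [darkTau_eq_det nn nn (fun _ _ => 1) (fun _ _ => (one_mul _).symm)]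
    simp only [mul_one]
    rfl
  have hzU : z ∈ U := by
    rw [hτ0] at hz
    exact hz
  have hφd : ∀ (j : Fin (M + 3)) (z : Fin (M + 3) → ℝ) i, HasPD j (φ i) _ z := fun j z i =>
    hasPD_rowFactor ξ₀ nn j i z
  have hψd : ∀ (j : Fin (M + 3)) (z : Fin (M + 3) → ℝ) i, HasPD j (ψ i) _ z := fun j z i =>
    hasPD_colFactor η₀ nn j i z
  have hX : Represents U T (fun z => e z) (coord 0) (covX p q) :=
    represents_covDeriv hpq (fun z i => by simpa [Fin.ext_iff] using hφd (coord 0) z i)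
      (fun z i => by simpa [Fin.ext_iff] using hψd (coord 0) z i) (fun i j => by simp)
  have hsq : ∀ (f : Fin N → ℂ) i, (f * f) i = f i ^ 2 := fun f i => (sq (f i)).symm
  have hY : Represents U T (fun z => e z) (coord 1) (covY p q) :=
    represents_covDeriv hpq
      (fun z i => by simpa [Fin.ext_iff, sq] using hφd (coord 1) z i)
      (fun z i => by rw [Pi.neg_apply, hsq]; simpa [Fin.ext_iff] using hψd (coord 1) z i)
      (fun i j => by simp; ring)
  have hcube : ∀ (f : Fin N → ℂ) i, (f * (f * f)) i = f i ^ 3 := fun f i => by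
    simp only [Pi.mul_apply]
    ring
  have hTt : Represents U T (fun z => e z) (coord 2) (covT p q) :=
    represents_covDeriv hpq
      (fun z i => by rw [hcube]; simpa [Fin.ext_iff] using hφd (coord 2) z i)
      (fun z i => by rw [hcube]; simpa [Fin.ext_iff] using hψd (coord 2) z i)
      (fun i j => by simp; ring)
  have hW : ∀ n, Represents U T (fun z => e z) (negCoord n) (covW (r n) (s n)) := fun n =>
    represents_covDeriv hpq
      (fun z i => by simpa [negCoord, coord, Fin.mk.injEq, Fin.val_inj] using hφd (negCoord n) z i)
      (fun z i => by simpa [negCoord, coord, Fin.mk.injEq, Fin.val_inj] using hψd (negCoord n) z i)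
      (fun i j => by
        have := hpa' i n
        have := hqa' j n
        simp only [List.map_cons, List.map_nil, List.sum_cons, List.sum_nil, r, s]
        field_simp
        ring)
  have h0 : Set.EqOn (darkTau c p q ξ₀ η₀ a nn) (fun z => T z * e z 1) U := fun z _ => by
    simp [hτ0]
  have h1 : ∀ k, Set.EqOn (darkTau c p q ξ₀ η₀ a (nn + Pi.single k 1))
      (fun z => T z * e z (1 - MvPolynomial.X (1, s k))) U := fun k z hz => by
    rw [darkTau_eq_det nn _ (fun i j => -((p i - a k) / (q j + a k))) (fun i j => by
      rw [prod_zpow_add_single _ (hxne i j), zpow_one])]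
    refine det_gramMatrix_add hz 1 (s k) fun i j => ?_
    have := hpq i j
    have := hqa' j k
    simp only [gramMatrix, Matrix.of_apply, s, Pi.one_apply]
    field_simp
    ring
  have hm : ∀ l, Set.EqOn (darkTau c p q ξ₀ η₀ a (nn - Pi.single l 1))
      (fun z => T z * e z (1 - MvPolynomial.X (r l, 1))) U := fun l z hz => by
    rw [darkTau_eq_det nn _ (fun i j => (-((p i - a l) / (q j + a l)))⁻¹) (fun i j => by
      rw [sub_eq_add_neg, ← Pi.single_neg, prod_zpow_add_single _ (hxne i j), zpow_neg_one])]
    refine det_gramMatrix_add hz (r l) 1 fun i j => ?_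
    have := hpq i j
    have := hqa' j l
    have := hpa' i l
    simp only [gramMatrix, Matrix.of_apply, r, Pi.one_apply]
    field_simp
    ring
  have h2 : Set.EqOn (darkTau c p q ξ₀ η₀ a (nn + Pi.single k 1 + Pi.single l 1))
      (fun z => T z * e z (shiftTwo p (s k) (s l) (a k))) U := fun z hz => by
    rw [darkTau_eq_det nn _
      (fun i j => (-((p i - a l) / (q j + a l))) * (-((p i - a k) / (q j + a k)))) (fun i j => by
      rw [prod_zpow_add_single _ (hxne i j), prod_zpow_add_single _ (hxne i j), zpow_one,
        zpow_one, mul_assoc])]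
    refine det_gramMatrix_shiftTwo hz (s k) (s l) (a k) fun i j => ?_
    have := hpq i j
    have := hqa' j l
    have := hqa' j k
    simp only [gramMatrix, Matrix.of_apply, s]
    field_simp
    ring
  have hU : IsOpen U := by
    have hc : Continuous (darkTau c p q ξ₀ η₀ a nn) := by
      unfold darkTau
      fun_prop
    rw [hτ0] at hc
    exact isOpen_ne_fun hc continuous_const
  have e0 : darkTau c p q ξ₀ η₀ a nn z = T z := congrFun hτ0 z
  refine ⟨?_, ?_, ?_, ?_, ?_⟩
  · have key := hirotaForm_toda (p := p) (bracket c p q φ ψ z) (hr k) (hs k)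
    rw [hirota_w_x, pd_pd_eq_hirotaForm hU hzU (hW k) hX h0 h0, h1 k hzU, hm k hzU, e0]
    linear_combination (T z) ^ 2 * key
  · have key := hirotaForm_mkp_two (p := p) (bracket c p q φ ψ z) (hs k)
    rw [hirota_xx k, hirota_y k, hirota_x k, pd_pd_eq_hirotaForm hU hzU hX hX (h1 k) h0,
      pd_eq_hirotaForm hU hzU hX (h1 k) h0, pd_eq_hirotaForm hU hzU hY (h1 k) h0]
    linear_combination (T z) ^ 2 * key
  · have key := hirotaForm_mkp_three (p := p) (bracket c p q φ ψ z) (hs k)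
    rw [hirota_xxx k, hirota_xx k, hirota_x_y k, hirota_y k, hirota_t k, hirota_x k,
      pd_pd_pd_eq_hirotaForm hU hzU hX hX hX (h1 k) h0,
      pd_pd_eq_hirotaForm hU hzU hX hX (h1 k) h0, pd_pd_eq_hirotaForm hU hzU hY hX (h1 k) h0,
      pd_eq_hirotaForm hU hzU hX (h1 k) h0, pd_eq_hirotaForm hU hzU hY (h1 k) h0,
      pd_eq_hirotaForm hU hzU hTt (h1 k) h0]
    linear_combination (T z) ^ 2 * key
  · have key := hirotaForm_mixed (p := p) (bracket c p q φ ψ z) (hs k) (hr l) (hs l)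
    rw [hirota_w_xx, hirota_w_y, hirota_w_x, hirota_x k,
      pd_pd_pd_eq_hirotaForm hU hzU (hW l) hX hX (h1 k) h0,
      pd_pd_eq_hirotaForm hU hzU (hW l) hY (h1 k) h0,
      pd_pd_eq_hirotaForm hU hzU (hW l) hX (h1 k) h0,
      pd_eq_hirotaForm hU hzU hX (h1 k) h0, h2 hzU, hm l hzU, h1 k hzU, e0]
    linear_combination (T z) ^ 2 * key
  · have key := hirotaForm_shift (p := p) (bracket c p q φ ψ z) (hs k) (hs l)
    rw [hirota_x k, pd_eq_hirotaForm hU hzU hX (h1 k) (h1 l), h2 hzU, h1 k hzU, h1 l hzU, e0]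
    linear_combination (T z) ^ 2 * key

end Generic

end Tau

section Density

open scoped ContDiff

variable {K : ℕ}

theorem contDiff_pd {F : ℝ × (Fin K → ℝ) → ℂ} (hF : ContDiff ℝ ∞ F) (j : Fin K) :
    ContDiff ℝ ∞ fun x : ℝ × (Fin K → ℝ) => pd j (fun s => F (x.1, s)) x.2 := by
  have h : (fun x : ℝ × (Fin K → ℝ) => pd j (fun s => F (x.1, s)) x.2)
      = fun x => fderiv ℝ F x (0, Pi.single j 1) := by
    funext x
    have h1 := (hF.differentiable (by simp)).differentiableAt (x := x)
    have h2 : HasDerivAt (fun s : ℝ => (x.1, Function.update x.2 j s))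
        ((0 : ℝ), (Pi.single j 1 : Fin K → ℝ)) (x.2 j) :=
      (hasDerivAt_const _ _).prodMk (hasDerivAt_update x.2 j (x.2 j))
    exact (HasFDerivAt.comp_hasDerivAt_of_eq (x.2 j) h1.hasFDerivAt h2 (by simp)).deriv
  rw [h]
  exact (hF.fderiv_right (by simp)).clm_apply contDiff_const

theorem contDiff_mixedPD {F : ℝ × (Fin K → ℝ) → ℂ} (hF : ContDiff ℝ ∞ F) (m : Fin K → ℕ) :
    ContDiff ℝ ∞ fun x : ℝ × (Fin K → ℝ) => mixedPD m (fun s => F (x.1, s)) x.2 := by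
  have hit : ∀ (j : Fin K) (k : ℕ) (G : ℝ → (Fin K → ℝ) → ℂ),
      ContDiff ℝ ∞ (fun x : ℝ × (Fin K → ℝ) => G x.1 x.2) →
      ContDiff ℝ ∞ fun x : ℝ × (Fin K → ℝ) => (pd j)^[k] (G x.1) x.2 := by
    intro j k
    induction k with
    | zero => exact fun G hG => hG
    | succ k ih => exact fun G hG => ih (fun ε => pd j (G ε)) (contDiff_pd hG j)
  unfold mixedPD
  induction List.finRange K with
  | nil => exact hF
  | cons j L ih =>
    exact hit j (m j) (fun ε => L.foldr (fun j G => (pd j)^[m j] G) fun s => F (ε, s)) ih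

theorem continuous_hirota {A B : ℝ → (Fin K → ℝ) → ℂ}
    (hA : ContDiff ℝ ∞ fun x : ℝ × (Fin K → ℝ) => A x.1 x.2)
    (hB : ContDiff ℝ ∞ fun x : ℝ × (Fin K → ℝ) => B x.1 x.2) (m : Fin K → ℕ) (z : Fin K → ℝ) :
    Continuous fun ε => Hirota m (A ε) (B ε) z := by
  have h : ContDiff ℝ ∞ fun x : ℝ × (Fin K → ℝ) => A x.1 (z + x.2) * B x.1 (z - x.2) :=
    (hA.comp (contDiff_fst.prodMk (contDiff_const.add contDiff_snd))).mul
      (hB.comp (contDiff_fst.prodMk (contDiff_const.sub contDiff_snd)))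
  exact (contDiff_mixedPD h m).continuous.comp 
    (by fun_prop : Continuous fun ε : ℝ => (ε, (0 : Fin K → ℝ)))

theorem dense_det_add_smul_one_ne_zero {n : Type*} [Fintype n] [DecidableEq n]
    (A : Matrix n n ℂ) : Dense {ε : ℝ | (A + (ε : ℂ) • (1 : Matrix n n ℂ)).det ≠ 0} := by
  have hfin : {ε : ℝ | (A + (ε : ℂ) • (1 : Matrix n n ℂ)).det = 0}.Finite := by
    have h0 := Polynomial.finite_setOfPred_isRoot (-A).charpoly_monic.ne_zero
    refine (h0.preimage Complex.ofReal_injective.injOn).subset fun ε hε => ?_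
    simp only [Set.mem_preimage, Set.mem_ofPred_eq, Polynomial.IsRoot.def, Matrix.eval_charpoly]
    rw [sub_neg_eq_add, add_comm, ← hε, Matrix.smul_one_eq_diagonal]
    rfl
  exact hfin.countable.dense_compl ℝ

variable {M N : ℕ} {c : Fin N → Fin N → ℂ} {p q ξ₀ η₀ : Fin N → ℂ} {a : Fin M → ℂ}

/-- The matrix `c` perturbed by a real multiple of the identity. -/
def perturb (c : Fin N → Fin N → ℂ) (ε : ℝ) (i j : Fin N) : ℂ :=
  c i j + if i = j then (ε : ℂ) else 0

theorem contDiff_darkTau_perturb (nn : Fin M → ℤ) :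
    ContDiff ℝ ∞ fun x : ℝ × (Fin (M + 3) → ℝ) =>
      darkTau (perturb c x.1) p q ξ₀ η₀ a nn x.2 := by
  have hz : ∀ j, ContDiff ℝ ∞ fun x : ℝ × (Fin (M + 3) → ℝ) => (x.2 j : ℂ) := fun j =>
    Complex.ofRealCLM.contDiff.comp ((contDiff_apply ℝ ℝ j).comp contDiff_snd)
  have hε : ContDiff ℝ ∞ fun x : ℝ × (Fin (M + 3) → ℝ) => (x.1 : ℂ) :=
    Complex.ofRealCLM.contDiff.comp contDiff_fst
  have hite : ∀ i j : Fin N, ContDiff ℝ ∞ fun x : ℝ × (Fin (M + 3) → ℝ) =>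
      if i = j then (x.1 : ℂ) else 0 := fun i j => by
    split_ifs
    exacts [hε, contDiff_const]
  simp only [darkTau, Matrix.det_apply, Matrix.of_apply, perturb, div_eq_mul_inv]
  fun_prop

theorem kpToda (hpq : ∀ i j, p i + q j ≠ 0) (hpa : ∀ i n, p i ≠ a n)
    (hqa : ∀ j n, q j ≠ -a n) (k l : Fin M) (nn : Fin M → ℤ) (z : Fin (M + 3) → ℝ) :
    KPToda a (darkTau c p q ξ₀ η₀ a) k l nn z := by
  have hdense : Dense {ε : ℝ | darkTau (perturb c ε) p q ξ₀ η₀ a nn z ≠ 0} := by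
    refine (dense_det_add_smul_one_ne_zero (Matrix.of fun i j => c i j + Complex.exp (
      (p i * (z (coord 0) : ℂ) + p i ^ 2 * (z (coord 1) : ℂ) + p i ^ 3 * (z (coord 2) : ℂ)
        + (∑ n, (z (negCoord n) : ℂ) / (p i - a n)) + ξ₀ i)
      + (q j * (z (coord 0) : ℂ) - q j ^ 2 * (z (coord 1) : ℂ) + q j ^ 3 * (z (coord 2) : ℂ)
        + (∑ n, (z (negCoord n) : ℂ) / (q j + a n)) + η₀ j)) / (p i + q j)
      * ∏ n, (-((p i - a n) / (q j + a n))) ^ (nn n))).mono fun ε hε =>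
      ne_of_eq_of_ne (congrArg Matrix.det (Matrix.ext fun i j => ?_)) hε
    simp [perturb, Matrix.one_apply]
    ring
  have hτ : ∀ n, Continuous fun ε => darkTau (perturb c ε) p q ξ₀ η₀ a n z := fun n =>
    (contDiff_darkTau_perturb n).continuous.comp (by fun_prop : Continuous fun ε : ℝ => (ε, z))
  have hH : ∀ m n n', Continuous fun ε => Hirota m (darkTau (perturb c ε) p q ξ₀ η₀ a n)
      (darkTau (perturb c ε) p q ξ₀ η₀ a n') z := fun m n n' =>
    continuous_hirota (contDiff_darkTau_perturb n) (contDiff_darkTau_perturb n') m z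
  have hzero : perturb c 0 = c := by
    funext i j
    simp [perturb]
  have hclosed : IsClosed {ε | KPToda a (darkTau (perturb c ε) p q ξ₀ η₀ a) k l nn z} := by
    unfold KPToda
    refine (isClosed_eq ?_ ?_).and ((isClosed_eq ?_ ?_).and ((isClosed_eq ?_ ?_).and
      ((isClosed_eq ?_ ?_).and (isClosed_eq ?_ ?_)))) <;> fun_prop
  have h : (0 : ℝ) ∈ {ε | KPToda a (darkTau (perturb c ε) p q ξ₀ η₀ a) k l nn z} :=
    hclosed.closure_subset_iff.2
      (fun ε hε => kpToda_of_ne_zero hpq hpa hqa k l nn z hε) (hdense 0)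
  rwa [Set.mem_ofPred_eq, hzero] at h

end Density

/-- KP–Toda bilinear identities for the dark Gram tau function.
The variables are `(x, y, t, x₋₁⁽¹⁾, …, x₋₁⁽ᴹ⁾) ∈ ℝ^{M+3}`, with `x, y, t` the
coordinates `0, 1, 2` and `x₋₁⁽ⁿ⁾` the coordinate `n + 3`. -/
theorem stmt12 (M N : ℕ) (hM : 1 ≤ M) (hN : 1 ≤ N)
    (c : Fin N → Fin N → ℂ) (p q ξ₀ η₀ : Fin N → ℂ) (a : Fin M → ℂ)
    (hpq : ∀ i j, p i + q j ≠ 0)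
    (hpa : ∀ i n, p i ≠ a n) (hqa : ∀ j n, q j ≠ -a n)
    (cx cy ct : Fin (M + 3)) (w : Fin M → Fin (M + 3))
    (hcx : cx = ⟨0, by omega⟩) (hcy : cy = ⟨1, by omega⟩) (hct : ct = ⟨2, by omega⟩)
    (hw : w = fun n => ⟨(n : ℕ) + 3, by have := n.isLt; omega⟩)
    (ξ η : Fin N → (Fin (M + 3) → ℝ) → ℂ)
    (hξ : ξ = fun i z =>
      p i * (z cx : ℂ) + p i ^ 2 * (z cy : ℂ) + p i ^ 3 * (z ct : ℂ)
        + (∑ n, (z (w n) : ℂ) / (p i - a n)) + ξ₀ i)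
    (hη : η = fun j z =>
      q j * (z cx : ℂ) - q j ^ 2 * (z cy : ℂ) + q j ^ 3 * (z ct : ℂ)
        + (∑ n, (z (w n) : ℂ) / (q j + a n)) + η₀ j)
    (τ : (Fin M → ℤ) → (Fin (M + 3) → ℝ) → ℂ)
    (hτ : τ = fun nn z => (Matrix.of fun i j =>
      c i j + Complex.exp (ξ i z + η j z) / (p i + q j)
        * ∏ n, (-((p i - a n) / (q j + a n))) ^ (nn n)).det) :
    ∀ (k l : Fin M) (nn : Fin M → ℤ) (z : Fin (M + 3) → ℝ),
      (Hirota (Pi.single (w k) 1 + Pi.single cx 1) (τ nn) (τ nn) z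
          - 2 * (τ nn z * τ nn z)
        = -2 * τ (nn + Pi.single k 1) z * τ (nn - Pi.single k 1) z)
      ∧ (Hirota (Pi.single cx 2) (τ (nn + Pi.single k 1)) (τ nn) z
          - Hirota (Pi.single cy 1) (τ (nn + Pi.single k 1)) (τ nn) z
          + 2 * a k * Hirota (Pi.single cx 1) (τ (nn + Pi.single k 1)) (τ nn) z = 0)
      ∧ (Hirota (Pi.single cx 3) (τ (nn + Pi.single k 1)) (τ nn) z
          + 3 * Hirota (Pi.single cx 1 + Pi.single cy 1) (τ (nn + Pi.single k 1)) (τ nn) z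
          - 4 * Hirota (Pi.single ct 1) (τ (nn + Pi.single k 1)) (τ nn) z
          + 3 * a k * (Hirota (Pi.single cx 2) (τ (nn + Pi.single k 1)) (τ nn) z
              + Hirota (Pi.single cy 1) (τ (nn + Pi.single k 1)) (τ nn) z)
          + 6 * a k ^ 2 * Hirota (Pi.single cx 1) (τ (nn + Pi.single k 1)) (τ nn) z = 0)
      ∧ (Hirota (Pi.single (w l) 1 + Pi.single cx 2) (τ (nn + Pi.single k 1)) (τ nn) z
          - Hirota (Pi.single (w l) 1 + Pi.single cy 1) (τ (nn + Pi.single k 1)) (τ nn) z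
          + 2 * a k * Hirota (Pi.single (w l) 1 + Pi.single cx 1)
              (τ (nn + Pi.single k 1)) (τ nn) z
          - 4 * (Hirota (Pi.single cx 1) (τ (nn + Pi.single k 1)) (τ nn) z
              + (a k - a l) * (τ (nn + Pi.single k 1) z * τ nn z))
          + 4 * (a k - a l) * (τ (nn + Pi.single k 1 + Pi.single l 1) z
              * τ (nn - Pi.single l 1) z) = 0)
      ∧ (Hirota (Pi.single cx 1) (τ (nn + Pi.single k 1)) (τ (nn + Pi.single l 1)) z
          + (a k - a l) * (τ (nn + Pi.single k 1) z * τ (nn + Pi.single l 1) z)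
          = (a k - a l) * (τ (nn + Pi.single k 1 + Pi.single l 1) z * τ nn z)) := by
  subst hcx hcy hct hw hξ hη hτ
  exact kpToda hpq hpa hqa

end
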